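/- arXiv:2007.00706 — 2 statements merged into one kernel-verified Lean document; each statement's English description precedes it below -/
import Mathlib

section
/- Let T > 0, R ≥ 0, L ≥ 0 be real numbers, let t be a real number, and let a : ℕ → ℝ be a sequence with a(k+1) ≥ a(k) + T for every k ∈ ℕ. Then the set {k ∈ ℕ : a(k) < t + L and t < a(k) + R} is finite and has at most ⌈(L + R)/T⌉ elements. -/
theorem add_nat_mul_le_of_add_le_succ {T : ℝ} {a : ℕ → ℝ} (ha : ∀ k, a k + T ≤ a (k + 1))
    (m n : ℕ) : a m + n * T ≤ a (m + n) := by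
  induction n with
  | zero => simp
  | succ n ih =>
    have h := ha (m + n)
    rw [← add_assoc]
    push_cast
    linarith

/-- η_j(L) ≤ ⌈(L + R_j)/T_j⌉: the number of jobs of a sporadic task with minimum
inter-arrival time `T` and worst-case response time `R` that can execute within a
window `[t, t + L]` is at most `⌈(L + R)/T⌉`. -/
theorem sporadic_job_count_bound
    (T R L t : ℝ) (hT : 0 < T) (hR : 0 ≤ R) (hL : 0 ≤ L)
    (a : ℕ → ℝ) (ha : ∀ k, a k + T ≤ a (k + 1)) :
    {k : ℕ | a k < t + L ∧ t < a k + R}.Finite ∧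
      ({k : ℕ | a k < t + L ∧ t < a k + R}.ncard : ℤ) ≤ ⌈(L + R) / T⌉ := by
  set S := {k : ℕ | a k < t + L ∧ t < a k + R}
  have hq : 0 ≤ (L + R) / T := by positivity
  obtain ⟨m, hm⟩ : ∃ m, S ⊆ (Finset.Ico m (m + ⌈(L + R) / T⌉₊) : Finset ℕ) := by
    rcases S.eq_empty_or_nonempty with h | h
    · exact ⟨0, by simp [h]⟩
    · refine ⟨sInf S, fun k hk => ?_⟩
      have hle : sInf S ≤ k := Nat.sInf_le hk
      have hmem : t < a (sInf S) + R := (Nat.sInf_mem h).2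
      obtain ⟨n, hn⟩ := Nat.exists_eq_add_of_le hle
      have hstep := add_nat_mul_le_of_add_le_succ ha (sInf S) n
      rw [← hn] at hstep
      have hlt : (n : ℝ) < (L + R) / T := by
        rw [lt_div_iff₀ hT]
        linarith [hk.1]
      have hceil : n < ⌈(L + R) / T⌉₊ := Nat.lt_ceil.2 hlt
      rw [Finset.coe_Ico, Set.mem_Ico]
      omega
  refine ⟨(Finset.finite_toSet _).subset hm, ?_⟩
  have hcard := Set.ncard_le_ncard hm (Finset.finite_toSet _)
  rw [Set.ncard_coe_finset, Nat.card_Ico, Nat.add_sub_cancel_left] at hcard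
  rw [← Int.natCast_ceil_eq_ceil hq]
  exact_mod_cast hcard
end

section
/- Let J be a finite index set. For each j ∈ J let T_j > 0, R_j ≥ 0, c_j ≥ 0 be real numbers and let a_j : ℕ → ℝ be a sequence with a_j(k+1) ≥ a_j(k) + T_j for every k. Let t be a real number and L ≥ 0. For each j ∈ J and k ∈ ℕ let w_{j,k} ≥ 0 be a real number such that w_{j,k} ≤ c_j, and w_{j,k} = 0 unless both a_j(k) < t + L and t < a_j(k) + R_j. Then Σ_{j ∈ J} Σ_{k ∈ ℕ} w_{j,k} ≤ Σ_{j ∈ J} ⌈(L + R_j)/T_j⌉ · c_j (the inner sums having finite support). -/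
theorem add_mul_le_of_add_le_succ {a : ℕ → ℝ} {T : ℝ} (ha : ∀ k, a k + T ≤ a (k + 1))
    (k n : ℕ) : a k + n * T ≤ a (k + n) := by
  induction n with
  | zero => simp
  | succ n ih =>
    have h := ha (k + n)
    rw [← add_assoc]
    push_cast
    linarith

theorem tsum_workload_le {T R c t L : ℝ} {a w : ℕ → ℝ} (hT : 0 < T) (hR : 0 ≤ R) (hc : 0 ≤ c)
    (hL : 0 ≤ L) (ha : ∀ k, a k + T ≤ a (k + 1)) (hwc : ∀ k, w k ≤ c)
    (hwz : ∀ k, w k ≠ 0 → a k < t + L ∧ t < a k + R) :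
    ∑' k, w k ≤ (⌈(L + R) / T⌉ : ℝ) * c := by
  classical
  have hx : 0 ≤ (L + R) / T := by positivity
  rw [← natCast_ceil_eq_intCast_ceil hx]
  by_cases hex : ∃ k, w k ≠ 0
  · set m := Nat.find hex with hm
    have hsupp : ∀ k ∉ Finset.Ico m (m + ⌈(L + R) / T⌉₊), w k = 0 := by
      intro k hk
      by_contra hne
      have hmk : m ≤ k := Nat.find_min' hex hne
      obtain ⟨n, rfl⟩ := Nat.exists_eq_add_of_le hmk
      have hgap := add_mul_le_of_add_le_succ ha m n
      have hfirst := (hwz m (Nat.find_spec hex)).2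
      have hlast := (hwz _ hne).1
      have hn : n < ⌈(L + R) / T⌉₊ := by
        rw [Nat.lt_ceil, lt_div_iff₀ hT]
        linarith
      exact hk (Finset.mem_Ico.2 ⟨hmk, by omega⟩)
    rw [tsum_eq_sum hsupp]
    simpa using Finset.sum_le_card_nsmul (Finset.Ico m (m + ⌈(L + R) / T⌉₊)) w c
      fun k _ => hwc k
  · push Not at hex
    simp only [hex, tsum_zero]
    positivity


/-- Workload-counting core of Eq. (2), ζ_i^k, and Lemma 6: summing per-job workloads
`w j k` (each at most `c j`, and nonzero only if job `k` of task `j` can execute in the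
window `[t, t + L]`) over all tasks is at most `Σ_j ⌈(L + R_j)/T_j⌉ · c_j`. -/
theorem sporadic_workload_bound
    {J : Type*} (Js : Finset J) (T R c : J → ℝ)
    (hT : ∀ j ∈ Js, 0 < T j) (hR : ∀ j ∈ Js, 0 ≤ R j) (hc : ∀ j ∈ Js, 0 ≤ c j)
    (a : J → ℕ → ℝ) (ha : ∀ j ∈ Js, ∀ k, a j k + T j ≤ a j (k + 1))
    (t L : ℝ) (hL : 0 ≤ L)
    (w : J → ℕ → ℝ)
    (hw0 : ∀ j ∈ Js, ∀ k, 0 ≤ w j k)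
    (hwc : ∀ j ∈ Js, ∀ k, w j k ≤ c j)
    (hwz : ∀ j ∈ Js, ∀ k, w j k ≠ 0 → a j k < t + L ∧ t < a j k + R j) :
    ∑ j ∈ Js, ∑' k : ℕ, w j k ≤ ∑ j ∈ Js, (⌈(L + R j) / T j⌉ : ℝ) * c j := by
  exact Finset.sum_le_sum fun j hj =>
    tsum_workload_le (hT j hj) (hR j hj) (hc j hj) hL (ha j hj) (hwc j hj) (hwz j hj)
end
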